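/- For every bounded linear functional L on H^1(μ) there exists a unique f ∈ BMO_1(μ) such that L(g) = ∫ f g dμ for every g ∈ H^{1,∞}_fin(μ), and ‖f‖_{BMO_1} ≤ C_2 ‖L‖_{(H^1)^*}, where C_2 is the constant in the equivalence of the H^{1,2} and H^{1,∞} norms. -/

import Mathlib

open MeasureTheory Set ENNReal Filter Function

/-- A weighted homogeneous tree setting: the homogeneous tree of order `m+1`
(a connected acyclic graph in which every vertex has `m+1` neighbours),
with a fixed doubly infinite geodesic `geo`, a numeration `idx` of `geo`,
the associated level function `level`, and the weighted measure `μ`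
with `μ {x} = m ^ level x`. -/
structure HomTreeSetting (m : ℕ) : Type 1 where
  V : Type
  measV : MeasurableSpace V
  measTop : measV = ⊤
  hm : 2 ≤ m
  G : SimpleGraph V
  conn : G.Connected
  acyclic : G.IsAcyclic
  deg : ∀ x : V, (G.neighborSet x).ncard = m + 1
  geo : Set V
  geoNbrs : ∀ v ∈ geo, (G.neighborSet v ∩ geo).ncard = 2
  geoGeodesic : ∀ u ∈ geo, ∀ v ∈ geo, ∀ w : V,
    G.dist u w + G.dist w v = G.dist u v → w ∈ geo
  idx : geo → ℤ
  idxBij : Function.Bijective idx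
  idxDist : ∀ x y : geo, |idx x - idx y| = (G.dist x.1 y.1 : ℤ)
  level : V → ℤ
  levelSpec : ∀ x : V, ∃ x' : geo,
    (∀ z : geo, G.dist x x'.1 ≤ G.dist x z.1) ∧
    level x = idx x' - (G.dist x x'.1 : ℤ)
  μ : @MeasureTheory.Measure V measV
  μspec : ∀ s : Set V, μ s = ∑' x : s, (m : ℝ≥0∞) ^ (level x.1)

attribute [instance] HomTreeSetting.measV

namespace HomTreeSetting

variable {m : ℕ}

/-- `x` lies below `y`. -/
def Below (S : HomTreeSetting m) (x y : S.V) : Prop :=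
  S.level x = S.level y - (S.G.dist x y : ℤ)

/-- An admissible trapezoid: either degenerate (a singleton, with height 1) or
the set of vertices lying below `root` whose level gap lies in `[ht, 2*ht)`. -/
structure AdmTrap (S : HomTreeSetting m) where
  root : S.V
  ht : ℕ
  ht_pos : 1 ≤ ht
  degen : Bool
  degen_ht : degen = true → ht = 1

variable {S : HomTreeSetting m}

/-- The underlying set of vertices of an admissible trapezoid. -/
def AdmTrap.set (R : S.AdmTrap) : Set S.V :=
  if R.degen then {R.root}
  else {x | S.Below x R.root ∧ (R.ht : ℤ) ≤ S.level R.root - S.level x ∧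
    S.level R.root - S.level x < 2 * (R.ht : ℤ)}

/-- The envelope (Calderón–Zygmund set) of an admissible trapezoid. -/
def AdmTrap.env (R : S.AdmTrap) : Set S.V :=
  if R.degen then {R.root}
  else {x | S.Below x R.root ∧ (R.ht : ℤ) ≤ 2 * (S.level R.root - S.level x) ∧
    S.level R.root - S.level x < 4 * (R.ht : ℤ)}

/-- The width `w(R) = m ^ ℓ(x_R)` of an admissible trapezoid. -/
noncomputable def AdmTrap.width (R : S.AdmTrap) : ℝ≥0∞ :=
  (m : ℝ≥0∞) ^ (S.level R.root)

/-- The dilated set `R̃* = {x : d(x, R̃) < h(R̃)/4}` of a Calderón–Zygmund set. -/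
def AdmTrap.star (R : S.AdmTrap) : Set S.V :=
  {x | ∃ y ∈ R.env, 4 * S.G.dist x y < R.ht}

variable (S)

/-- `E` is a Calderón–Zygmund set, i.e. the envelope of an admissible trapezoid. -/
def IsCZ (E : Set S.V) : Prop := ∃ R : S.AdmTrap, E = R.env

/-- Average of `f` over the set `E` with respect to `μ`. -/
noncomputable def avg (f : S.V → ℂ) (E : Set S.V) : ℂ :=
  (S.μ E).toReal⁻¹ • ∫ x in E, f x ∂S.μ

/-- The `q`-mean oscillation `(μ(E)⁻¹ ∫_E |f - f_E|^q dμ)^(1/q)` of `f` on `E`. -/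
noncomputable def osc (q : ℝ) (f : S.V → ℂ) (E : Set S.V) : ℝ :=
  ((S.μ E).toReal⁻¹ * ∫ x in E, ‖f x - S.avg f E‖ ^ q ∂S.μ) ^ (1 / q)

/-- The `BMO_q(μ)` (semi)norm. -/
noncomputable def bmoNorm (q : ℝ) (f : S.V → ℂ) : ℝ :=
  ⨆ R : S.AdmTrap, S.osc q f R.env

/-- Membership in `BMO_q(μ)`. -/
def MemBMO (q : ℝ) (f : S.V → ℂ) : Prop :=
  BddAbove (Set.range fun R : S.AdmTrap => S.osc q f R.env)

/-- A `(1,p)`-atom (`p = ⊤` gives `(1,∞)`-atoms). -/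
def IsAtom (p : ℝ≥0∞) (a : S.V → ℂ) : Prop :=
  ∃ R : S.AdmTrap, Function.support a ⊆ R.env ∧
    eLpNorm a p S.μ ≤ S.μ R.env ^ ((p⁻¹).toReal - 1) ∧
    ∫ x, a x ∂S.μ = 0

/-- `f = ∑ j, c j • a j` is an atomic decomposition of `f` with `(1,p)`-atoms
`a j` and `∑ j, ‖c j‖ < ∞`, the series converging to `f` in `L¹(μ)`. -/
def IsAtomicDecomp (p : ℝ≥0∞) (f : S.V → ℂ) (c : ℕ → ℂ) (a : ℕ → S.V → ℂ) : Prop :=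
  (∀ j, S.IsAtom p (a j)) ∧ Summable (fun j => ‖c j‖) ∧
  Filter.Tendsto
    (fun n => eLpNorm (fun x => f x - ∑ j ∈ Finset.range n, c j * a j x) 1 S.μ)
    Filter.atTop (nhds 0)

/-- Membership in the atomic Hardy space `H^{1,p}(μ)`. -/
def MemH1 (p : ℝ≥0∞) (f : S.V → ℂ) : Prop :=
  MeasureTheory.Integrable f S.μ ∧ ∃ c a, S.IsAtomicDecomp p f c a

/-- The `H^{1,p}(μ)` norm: infimum of `∑ j, ‖c j‖` over atomic decompositions. -/
noncomputable def h1Norm (p : ℝ≥0∞) (f : S.V → ℂ) : ℝ :=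
  sInf {t : ℝ | ∃ c a, S.IsAtomicDecomp p f c a ∧ t = ∑' j, ‖c j‖}

/-- Membership in `H^{1,p}_fin(μ)`: finite linear combinations of `(1,p)`-atoms. -/
def MemH1fin (p : ℝ≥0∞) (f : S.V → ℂ) : Prop :=
  ∃ (n : ℕ) (c : ℕ → ℂ) (a : ℕ → S.V → ℂ),
    (∀ j, j < n → S.IsAtom p (a j)) ∧
    f = fun x => ∑ j ∈ Finset.range n, c j * a j x

/-- The sharp maximal function `f^{♯,q}`. -/
noncomputable def sharpMax (q : ℝ) (f : S.V → ℂ) (x : S.V) : ℝ :=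
  ⨆ R : {R : S.AdmTrap // x ∈ R.env}, S.osc q f R.1.env

end HomTreeSetting

namespace HomTreeSetting

section Tree

variable {m : ℕ} (S : HomTreeSetting m)

theorem isTree : S.G.IsTree := ⟨S.conn, S.acyclic⟩

variable {S}

theorem length_eq_dist_of_isPath {u v : S.V} {p : S.G.Walk u v} (hp : p.IsPath) :
    p.length = S.G.dist u v := by
  obtain ⟨q, hq, hl⟩ := S.conn.exists_path_of_dist u v
  have h := (S.acyclic.subsingleton_path u v).elim ⟨p, hp⟩ ⟨q, hq⟩
  rw [Subtype.mk.injEq] at h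
  rw [h, hl]

theorem dist_add_dist_of_mem_support {u v w : S.V} {p : S.G.Walk u v}
    (hp : p.length = S.G.dist u v) (hw : w ∈ p.support) :
    S.G.dist u w + S.G.dist w v = S.G.dist u v := by
  classical
  have h := congrArg SimpleGraph.Walk.length (p.take_spec hw)
  rw [SimpleGraph.Walk.length_append] at h
  have h1 := SimpleGraph.dist_le (p.takeUntil w hw)
  have h2 := SimpleGraph.dist_le (p.dropUntil w hw)
  have h3 := S.conn.dist_triangle (u := u) (v := w) (w := v)
  omega

/-- Distances to points of the geodesic factor through a nearest point. -/
theorem dist_eq_of_nearest {x : S.V} {x' : S.geo}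
    (hx : ∀ z : S.geo, S.G.dist x x'.1 ≤ S.G.dist x z.1) (z : S.geo) :
    S.G.dist x z.1 = S.G.dist x x'.1 + S.G.dist x'.1 z.1 := by
  obtain ⟨p, hp, hpl⟩ := S.conn.exists_path_of_dist x x'.1
  obtain ⟨q, hq, hql⟩ := S.conn.exists_path_of_dist x'.1 z.1
  have hpq : (p.append q).IsPath := by
    rw [SimpleGraph.Walk.isPath_def, SimpleGraph.Walk.support_append, List.nodup_append']
    refine ⟨hp.support_nodup, hq.support_nodup.tail, ?_⟩
    intro w hwp hwq
    have h1 := dist_add_dist_of_mem_support hpl hwp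
    have h2 := dist_add_dist_of_mem_support hql (List.mem_of_mem_tail hwq)
    have hg := hx ⟨w, S.geoGeodesic _ x'.2 _ z.2 _ h2⟩
    have h0 : S.G.dist w x'.1 = 0 := by simp only at hg; omega
    have hw : w = x'.1 := S.conn.dist_eq_zero_iff.1 h0
    have hn := hq.support_nodup
    rw [← SimpleGraph.Walk.cons_tail_support, List.nodup_cons] at hn
    exact hn.1 (hw ▸ hwq)
  rw [← length_eq_dist_of_isPath hpq, SimpleGraph.Walk.length_append, hpl, hql]

/-- The level function is a Busemann function of the fixed geodesic. -/
theorem exists_level_eq (x : S.V) :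
    ∃ N : ℤ, ∀ z : S.geo, N ≤ S.idx z → S.level x = S.idx z - (S.G.dist x z.1 : ℤ) := by
  obtain ⟨x', hx, hl⟩ := S.levelSpec x
  refine ⟨S.idx x', fun z hz => ?_⟩
  have h := S.idxDist z x'
  rw [abs_of_nonneg (by omega), SimpleGraph.dist_comm] at h
  rw [hl, dist_eq_of_nearest hx z]
  push_cast
  omega

theorem exists_parent (x : S.V) : ∃ y, S.G.Adj x y ∧ S.level y = S.level x + 1 ∧
    ∀ z, S.G.Adj x z → z ≠ y → S.level z = S.level x - 1 := by
  choose N hN using fun x : S.V => exists_level_eq x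
  have hfin : (S.G.neighborSet x).Finite :=
    Set.finite_of_ncard_ne_zero (by rw [S.deg]; omega)
  obtain ⟨B, hB⟩ := (hfin.image N).bddAbove
  obtain ⟨z, hz⟩ := S.idxBij.2 (max B (max (N x) (S.level x + 1)))
  have hzB : ∀ y, S.G.Adj x y → S.level y = S.idx z - (S.G.dist y z.1 : ℤ) := fun y hy =>
    hN y z (by rw [hz]; exact (hB ⟨y, hy, rfl⟩).trans (le_max_left _ _))
  have hzx := hN x z (by rw [hz]; exact (le_max_left _ _).trans (le_max_right _ _))
  have hzl : S.level x + 1 ≤ S.idx z := by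
    rw [hz]; exact (le_max_right _ _).trans (le_max_right _ _)
  obtain ⟨p, hp, hpl⟩ := S.conn.exists_path_of_dist x z.1
  cases p with
  | nil => simp at hzx; omega
  | @cons _ y _ hxy p =>
    rw [SimpleGraph.Walk.length_cons] at hpl
    have hdy : S.G.dist x z.1 = S.G.dist y z.1 + 1 := by
      have h1 := SimpleGraph.dist_le p
      have h2 := S.isTree.dist_eq_dist_add_one_of_adj z.1 hxy
      rw [SimpleGraph.dist_comm (u := z.1) (v := x),
        SimpleGraph.dist_comm (u := z.1) (v := y)] at h2
      omega
    refine ⟨y, hxy, by rw [hzB y hxy, hzx, hdy]; push_cast; ring, fun w hw hwy => ?_⟩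
    rw [hzB w hw, hzx]
    have h2 := S.isTree.dist_eq_dist_add_one_of_adj z.1 hw
    rw [SimpleGraph.dist_comm (u := z.1) (v := x), SimpleGraph.dist_comm (u := z.1) (v := w)] at h2
    rcases h2 with h2 | h2
    · exfalso
      obtain ⟨q, hq, hql⟩ := S.conn.exists_path_of_dist w z.1
      have hc : (SimpleGraph.Walk.cons hw q).IsPath :=
        SimpleGraph.Walk.isPath_of_length_eq_dist _ (by simp [hql, h2])
      have h := (S.acyclic.subsingleton_path _ _).elim ⟨_, hp⟩ ⟨_, hc⟩
      rw [Subtype.mk.injEq, SimpleGraph.Walk.cons.injEq] at h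
      exact hwy h.1.symm
    · rw [h2]; push_cast; ring

/-- The neighbour of `x` lying one level above `x`. -/
noncomputable def parent (x : S.V) : S.V := (exists_parent x).choose

theorem adj_parent (x : S.V) : S.G.Adj x (parent x) := (exists_parent x).choose_spec.1

theorem level_parent (x : S.V) : S.level (parent x) = S.level x + 1 :=
  (exists_parent x).choose_spec.2.1

theorem level_of_adj_of_ne {x z : S.V} (h : S.G.Adj x z) (hz : z ≠ parent x) :
    S.level z = S.level x - 1 :=
  (exists_parent x).choose_spec.2.2 z h hz

theorem parent_eq_or_of_adj {x y : S.V} (h : S.G.Adj x y) : parent x = y ∨ parent y = x := by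
  by_contra! hc
  have h1 := level_of_adj_of_ne h hc.1.symm
  have h2 := level_of_adj_of_ne h.symm hc.2.symm
  omega

theorem level_iterate_parent (k : ℕ) (x : S.V) : S.level (parent^[k] x) = S.level x + k := by
  induction k generalizing x with
  | zero => simp
  | succ k ih => rw [Function.iterate_succ_apply, ih, level_parent]; push_cast; ring

theorem setOf_parent_eq (y : S.V) :
    {z : S.V | parent z = y} = S.G.neighborSet y \ {parent y} := by
  ext z
  simp only [mem_ofPred_eq, Set.mem_sdiff, SimpleGraph.mem_neighborSet, mem_singleton_iff]
  constructor
  · rintro rfl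
    refine ⟨(adj_parent z).symm, fun h => ?_⟩
    have h1 := level_parent z
    have h2 := level_parent (parent z)
    rw [← h] at h2
    omega
  · rintro ⟨h, hz⟩
    exact (parent_eq_or_of_adj h.symm).resolve_right fun h' => hz h'.symm

theorem finite_setOf_parent_eq (y : S.V) : {z : S.V | parent z = y}.Finite := by
  rw [setOf_parent_eq]
  exact (Set.finite_of_ncard_ne_zero (by rw [S.deg]; omega)).sdiff

theorem ncard_setOf_parent_eq (y : S.V) : {z : S.V | parent z = y}.ncard = m := by
  rw [setOf_parent_eq,
    Set.ncard_sdiff_singleton_of_mem (show _ ∈ S.G.neighborSet y from adj_parent y), S.deg,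
    Nat.add_sub_cancel]

/-- The vertices whose parent is `y`. -/
noncomputable def children (y : S.V) : Finset S.V := (finite_setOf_parent_eq y).toFinset

theorem mem_children {y z : S.V} : z ∈ children y ↔ parent z = y := by
  simp [children]

theorem card_children (y : S.V) : (children y).card = m := by
  rw [children, ← Set.ncard_eq_toFinset_card _ (finite_setOf_parent_eq y), ncard_setOf_parent_eq]

theorem level_sub_le_dist (x y : S.V) : S.level y - S.level x ≤ S.G.dist x y := by
  obtain ⟨p, hp⟩ := S.conn.exists_walk_length_eq_dist x y
  rw [← hp]
  clear hp
  induction p with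
  | nil => simp
  | @cons x z y h p ih =>
    rw [SimpleGraph.Walk.length_cons]
    push_cast
    rcases parent_eq_or_of_adj h with h | h
    · have := level_parent x; rw [h] at this; omega
    · have := level_parent z; rw [h] at this; omega

theorem iterate_parent_of_walk {x y : S.V} (p : S.G.Walk x y)
    (h : S.level y = S.level x + p.length) : parent^[p.length] x = y := by
  induction p with
  | nil => simp
  | @cons x z y hxz p ih =>
    rw [SimpleGraph.Walk.length_cons] at h ⊢
    push_cast at h
    have hd := (level_sub_le_dist z y).trans (Int.ofNat_le.2 (SimpleGraph.dist_le p))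
    rcases parent_eq_or_of_adj hxz with hp | hp
    · have := level_parent x
      rw [hp] at this
      rw [Function.iterate_succ_apply, hp]
      exact ih (by omega)
    · have := level_parent z; rw [hp] at this; omega

theorem dist_iterate_parent (k : ℕ) (x : S.V) : S.G.dist x (parent^[k] x) = k := by
  apply le_antisymm
  · induction k generalizing x with
    | zero => simp
    | succ k ih =>
      rw [Function.iterate_succ_apply]
      have h1 := ih (parent x)
      have h2 := S.conn.dist_triangle (u := x) (v := parent x) (w := parent^[k] (parent x))
      rw [SimpleGraph.dist_eq_one_iff_adj.2 (adj_parent x)] at h2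
      omega
  · have h := level_sub_le_dist x (parent^[k] x)
    rw [level_iterate_parent] at h
    omega

theorem iterate_parent_eq_iff (k : ℕ) (x y : S.V) :
    parent^[k] x = y ↔ S.Below x y ∧ S.level y - S.level x = k := by
  constructor
  · rintro rfl
    rw [Below, dist_iterate_parent, level_iterate_parent]
    exact ⟨by ring, by ring⟩
  · rintro ⟨h1, h2⟩
    obtain ⟨p, hp⟩ := S.conn.exists_walk_length_eq_dist x y
    rw [Below, ← hp] at h1
    have hk : k = p.length := by omega
    rw [hk]
    exact iterate_parent_of_walk p (by omega)

theorem exists_common_ancestor (x y : S.V) :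
    ∃ i j : ℕ, parent^[i] x = (parent^[j] y : S.V) := by
  obtain ⟨p, -⟩ := S.conn.exists_walk_length_eq_dist x y
  induction p with
  | nil => exact ⟨0, 0, rfl⟩
  | @cons x z y h p ih =>
    obtain ⟨i, j, hij⟩ := ih
    rcases parent_eq_or_of_adj h with h | h
    · exact ⟨i + 1, j, by rw [Function.iterate_succ_apply, h, hij]⟩
    · refine ⟨i, j + 1, ?_⟩
      rw [← h, ← Function.iterate_succ_apply, Function.iterate_succ_apply', hij,
        Function.iterate_succ_apply']

end Tree

section Weight

variable {m : ℕ} (S : HomTreeSetting m)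

/-- The mass of a single vertex. -/
noncomputable def weight (x : S.V) : ℝ := (m : ℝ) ^ S.level x

/-- The mass of a finite set of vertices. -/
noncomputable def mass (E : Finset S.V) : ℝ := ∑ x ∈ E, S.weight x

variable {S}

theorem order_pos (S : HomTreeSetting m) : (0 : ℝ) < m := by
  have := S.hm
  exact_mod_cast (by omega : 0 < m)

theorem weight_pos (x : S.V) : 0 < S.weight x := zpow_pos S.order_pos _

theorem weight_parent (x : S.V) : S.weight (parent x) = m * S.weight x := by
  rw [weight, weight, level_parent, zpow_add_one₀ S.order_pos.ne', mul_comm]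

theorem mass_pos {E : Finset S.V} (hE : E.Nonempty) : 0 < S.mass E :=
  Finset.sum_pos (fun x _ => weight_pos x) hE

theorem mass_nonneg (E : Finset S.V) : 0 ≤ S.mass E :=
  Finset.sum_nonneg fun x _ => (weight_pos x).le

theorem sum_weight_children (y : S.V) : ∑ z ∈ children y, S.weight z = S.weight y := by
  have h : ∀ z ∈ children y, S.weight z = S.weight y / m := fun z hz => by
    rw [← mem_children.1 hz, weight_parent, mul_div_cancel_left₀ _ S.order_pos.ne']
  rw [Finset.sum_congr rfl h, Finset.sum_const, card_children, nsmul_eq_mul,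
    mul_div_cancel₀ _ S.order_pos.ne']

open Classical in
/-- The descendants of `y` lying `k` levels below `y`. -/
noncomputable def desc (y : S.V) : ℕ → Finset S.V
  | 0 => {y}
  | k + 1 => (desc y k).biUnion children

theorem mem_desc {x y : S.V} {k : ℕ} : x ∈ desc y k ↔ parent^[k] x = y := by
  induction k generalizing x with
  | zero => simp [desc]
  | succ k ih =>
    simp only [desc, Finset.mem_biUnion, ih, mem_children, Function.iterate_succ_apply]
    simp

theorem mass_desc (y : S.V) (k : ℕ) : S.mass (desc y k) = S.weight y := by
  classical
  induction k with
  | zero => simp [desc, mass]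
  | succ k ih =>
    rw [mass, desc, Finset.sum_biUnion]
    · simp only [sum_weight_children]
      exact ih
    · intro z _ z' _ hzz
      refine Finset.disjoint_left.2 fun x hx hx' => hzz ?_
      rw [← mem_children.1 hx, mem_children.1 hx']

open Classical in
/-- The descendants of `y` lying at least `a` and less than `b` levels below `y`. -/
noncomputable def trap (y : S.V) (a b : ℕ) : Finset S.V := (Finset.Ico a b).biUnion (desc y)

theorem mem_trap {x y : S.V} {a b : ℕ} :
    x ∈ trap y a b ↔ ∃ k, (a ≤ k ∧ k < b) ∧ parent^[k] x = y := by
  simp [trap, mem_desc]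

theorem mass_trap (y : S.V) {a b : ℕ} (hab : a ≤ b) :
    S.mass (trap y a b) = ((b : ℝ) - a) * S.weight y := by
  classical
  rw [mass, trap, Finset.sum_biUnion]
  · rw [Finset.sum_congr rfl fun k _ =>
      show ∑ x ∈ desc y k, S.weight x = _ from mass_desc y k, Finset.sum_const, Nat.card_Ico,
      nsmul_eq_mul, Nat.cast_sub hab]
  · intro k _ l _ hkl
    refine Finset.disjoint_left.2 fun x hx hx' => hkl ?_
    have h1 := ((iterate_parent_eq_iff k x y).1 (mem_desc.1 hx)).2
    have h2 := ((iterate_parent_eq_iff l x y).1 (mem_desc.1 hx')).2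
    omega

namespace AdmTrap

/-- The Calderón–Zygmund set of `R` as a finite set. -/
noncomputable def envFinset (R : S.AdmTrap) : Finset S.V :=
  if R.degen then {R.root} else trap R.root ((R.ht + 1) / 2) (4 * R.ht)

theorem coe_envFinset (R : S.AdmTrap) : (R.envFinset : Set S.V) = R.env := by
  rw [envFinset, env]
  split_ifs with h
  · simp
  · ext x
    simp only [Finset.mem_coe, mem_trap, iterate_parent_eq_iff, mem_ofPred_eq]
    constructor
    · rintro ⟨k, hk, hb, hl⟩
      exact ⟨hb, by omega, by omega⟩
    · rintro ⟨hb, h1, h2⟩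
      obtain ⟨k, hk⟩ := Int.eq_ofNat_of_zero_le (show 0 ≤ S.level R.root - S.level x by omega)
      exact ⟨k, by omega, hb, hk⟩

theorem envFinset_nonempty (R : S.AdmTrap) : R.envFinset.Nonempty := by
  by_contra hne
  rw [Finset.not_nonempty_iff_eq_empty] at hne
  have hpos := R.ht_pos
  have h0 : S.mass R.envFinset = 0 := by rw [hne, mass, Finset.sum_empty]
  rw [envFinset] at h0
  split_ifs at h0
  · simp only [mass, Finset.sum_singleton] at h0
    exact (weight_pos _).ne' h0
  · rw [mass_trap _ (by omega)] at h0
    have h1 : (((R.ht + 1) / 2 : ℕ) : ℝ) < ((4 * R.ht : ℕ) : ℝ) := by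
      exact_mod_cast (by omega : (R.ht + 1) / 2 < 4 * R.ht)
    exact (mul_pos (sub_pos.2 h1) (weight_pos R.root)).ne' h0

end AdmTrap

/-- Finite sets that can be cut into single vertices by repeated partitions, in such a way that
every piece occurring has mass at least `D⁻¹` times that of the set it is cut from and is
contained in a Calderón–Zygmund set of comparable mass. -/
inductive Divisible (D : ℝ) : Finset S.V → Prop
  | single (x : S.V) : Divisible D {x}
  | split {Q : Finset S.V} {ι : Type} (s : Finset ι) (P : ι → Finset S.V)
      (mem_iff : ∀ x, x ∈ Q ↔ ∃ i ∈ s, x ∈ P i)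
      (disj : (s : Set ι).PairwiseDisjoint P)
      (piece : ∀ i ∈ s, Divisible D (P i))
      (mass_le : ∀ i ∈ s, S.mass Q ≤ D * S.mass (P i))
      (cover : ∃ R : S.AdmTrap, Q ⊆ R.envFinset ∧ S.mass R.envFinset ≤ 14 * S.mass Q) :
      Divisible D Q

theorem trap_cover (y : S.V) {a b : ℕ} (ha : 1 ≤ a) (h1 : 3 * a ≤ 2 * b) (h2 : b ≤ 8 * a) :
    ∃ R : S.AdmTrap, trap y a b ⊆ R.envFinset ∧
      S.mass R.envFinset ≤ 14 * S.mass (trap y a b) := by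
  refine ⟨⟨y, 2 * a, by omega, false, by simp⟩, ?_⟩
  simp only [AdmTrap.envFinset, Bool.false_eq_true, if_false]
  refine ⟨fun x hx => ?_, ?_⟩
  · obtain ⟨k, hk, hx⟩ := mem_trap.1 hx
    exact mem_trap.2 ⟨k, by omega, hx⟩
  · rw [mass_trap _ (by omega), mass_trap _ (by omega), ← mul_assoc 14]
    refine mul_le_mul_of_nonneg_right ?_ (weight_pos y).le
    have e : (2 * a + 1) / 2 = a := by omega
    have h1' : (3 * a : ℝ) ≤ 2 * b := by exact_mod_cast h1
    rw [e]
    push_cast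
    linarith

theorem divisible_trap (n : ℕ) (y : S.V) (a b : ℕ) (hn : 2 * b ≤ n + a) (hab : a < b)
    (h1 : 3 * a ≤ 2 * b) (h2 : b ≤ 8 * a ∨ a = 0 ∧ b = 1) :
    Divisible (7 * m : ℝ) (trap y a b) := by
  have hm1 : (1 : ℝ) ≤ m := by exact_mod_cast (by have := S.hm; omega : 1 ≤ m)
  induction n generalizing y a b with
  | zero => omega
  | succ n ih =>
    rcases h2 with h2 | ⟨rfl, rfl⟩
    swap
    · have : trap y 0 1 = {y} := by simp [trap, desc]
      rw [this]
      exact .single y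
    by_cases h3 : 3 * a ≤ b
    · have h2' : (b : ℝ) ≤ 8 * a := by exact_mod_cast h2
      have h3' : (3 * a : ℝ) ≤ b := by exact_mod_cast h3
      have hw := weight_pos y
      refine .split (Finset.univ : Finset Bool)
        (fun i => if i then trap y a (2 * a) else trap y (2 * a) b) ?_ ?_ ?_ ?_
        (trap_cover y (by omega) h1 h2)
      · intro x
        simp only [Finset.mem_univ, true_and, Bool.exists_bool, Bool.false_eq_true, if_false,
          if_true, mem_trap]
        constructor
        · rintro ⟨k, hk, hx⟩
          by_cases hka : k < 2 * a
          · exact Or.inr ⟨k, by omega, hx⟩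
          · exact Or.inl ⟨k, by omega, hx⟩
        · rintro (⟨k, hk, hx⟩ | ⟨k, hk, hx⟩) <;> exact ⟨k, by omega, hx⟩
      · have hd : Disjoint (trap y a (2 * a)) (trap y (2 * a) b) := by
          refine Finset.disjoint_left.2 fun x hx hx' => ?_
          obtain ⟨k, hk, hx⟩ := mem_trap.1 hx
          obtain ⟨l, hl, hx'⟩ := mem_trap.1 hx'
          have h1 := ((iterate_parent_eq_iff k x y).1 hx).2
          have h2 := ((iterate_parent_eq_iff l x y).1 hx').2
          omega
        intro i _ j _ hij
        cases i <;> cases j <;> simp_all [Function.onFun, disjoint_comm]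
      · rintro (_ | _) -
        · exact ih y (2 * a) b (by omega) (by omega) (by omega) (by omega)
        · exact ih y a (2 * a) (by omega) (by omega) (by omega) (by omega)
      · rintro (_ | _) -
        · simp only [Bool.false_eq_true, if_false]
          rw [mass_trap _ (by omega), mass_trap _ (by omega), ← mul_assoc (7 * m : ℝ)]
          push_cast
          refine mul_le_mul_of_nonneg_right ?_ hw.le
          nlinarith
        · simp only [if_true]
          rw [mass_trap _ (by omega), mass_trap _ (by omega), ← mul_assoc (7 * m : ℝ)]
          push_cast
          refine mul_le_mul_of_nonneg_right ?_ hw.le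
          have ha0 : (0 : ℝ) ≤ a := Nat.cast_nonneg a
          nlinarith
    · obtain ⟨a, rfl⟩ : ∃ a', a = a' + 1 := ⟨a - 1, by omega⟩
      obtain ⟨b, rfl⟩ : ∃ b', b = b' + 1 := ⟨b - 1, by omega⟩
      refine .split (children y) (fun z => trap z a b) ?_ ?_ ?_ ?_
        (trap_cover y (by omega) h1 h2)
      · intro x
        simp only [mem_trap, mem_children]
        constructor
        · rintro ⟨k, hk, hx⟩
          obtain ⟨k, rfl⟩ : ∃ k', k = k' + 1 := ⟨k - 1, by omega⟩
          rw [Function.iterate_succ_apply'] at hx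
          exact ⟨_, hx, k, by omega, rfl⟩
        · rintro ⟨z, hz, k, hk, hx⟩
          exact ⟨k + 1, by omega, by rw [Function.iterate_succ_apply', hx, hz]⟩
      · intro z hz z' hz' hzz
        refine Finset.disjoint_left.2 fun x hx hx' => hzz ?_
        obtain ⟨k, hk, hx⟩ := mem_trap.1 hx
        obtain ⟨l, hl, hx'⟩ := mem_trap.1 hx'
        have h1 := ((iterate_parent_eq_iff k x z).1 hx).2
        have h2 := ((iterate_parent_eq_iff l x z').1 hx').2
        have h3 := level_parent z
        have h4 := level_parent z'
        rw [mem_children.1 hz] at h3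
        rw [mem_children.1 hz'] at h4
        have hkl : k = l := by omega
        rw [← hx, ← hx', hkl]
      · exact fun z _ => ih z a b (by omega) (by omega) (by omega) (by omega)
      · intro z hz
        rw [mass_trap _ (by omega), mass_trap _ (by omega), ← mem_children.1 hz, weight_parent]
        push_cast
        have hba : (0 : ℝ) ≤ b - a := sub_nonneg.2 (by exact_mod_cast (by omega : a ≤ b))
        have := mul_nonneg hba (mul_nonneg S.order_pos.le (weight_pos z).le)
        nlinarith

theorem divisible_envFinset (R : S.AdmTrap) : Divisible (7 * m : ℝ) R.envFinset := by
  have := R.ht_pos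
  rw [AdmTrap.envFinset]
  split_ifs
  · exact .single _
  · exact divisible_trap (8 * R.ht) _ _ _ (by omega) (by omega) (by omega) (by omega)

end Weight

section Atoms

variable {m : ℕ} {S : HomTreeSetting m}

instance instMeasurableSingletonClass : MeasurableSingletonClass S.V :=
  ⟨fun x => by
    have h : ∀ s : Set S.V, @MeasurableSet S.V S.measV s := by
      rw [S.measTop]; exact fun _ => trivial
    exact h _⟩

theorem measurable_of_vertices {β : Type*} [MeasurableSpace β] (u : S.V → β) : Measurable u := by
  have h : ∀ s : Set S.V, @MeasurableSet S.V S.measV s := by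
    rw [S.measTop]; exact fun _ => trivial
  exact fun s _ => h _

theorem aestronglyMeasurable_of_vertices (u : S.V → ℂ) (ν : Measure S.V) :
    AEStronglyMeasurable u ν :=
  (measurable_of_vertices u).aestronglyMeasurable

theorem measure_singleton (x : S.V) : S.μ {x} = ENNReal.ofReal (S.weight x) := by
  have hm0 : (m : NNReal) ≠ 0 := by exact_mod_cast S.order_pos.ne'
  rw [S.μspec, tsum_singleton x fun y => (m : ℝ≥0∞) ^ S.level y, weight]
  have h : ((m : ℝ) ^ S.level x) = (((m : NNReal) ^ S.level x : NNReal) : ℝ) := by push_cast; rfl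
  rw [h, ENNReal.ofReal_coe_nnreal, ENNReal.coe_zpow hm0]
  rfl

theorem measure_finset (E : Finset S.V) : S.μ E = ENNReal.ofReal (S.mass E) := by
  rw [← sum_measure_singleton, mass, ENNReal.ofReal_sum_of_nonneg fun x _ => (weight_pos x).le]
  exact Finset.sum_congr rfl fun x _ => measure_singleton x

theorem measureReal_singleton (x : S.V) : S.μ.real {x} = S.weight x := by
  rw [measureReal_def, measure_singleton, ENNReal.toReal_ofReal (weight_pos x).le]

theorem integrableOn_finset {F : Type*} [NormedAddCommGroup F] (u : S.V → F) (E : Finset S.V) :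
    IntegrableOn u E S.μ := by
  rw [← (E : Set S.V).biUnion_of_singleton]
  simp [integrableOn_finset_iUnion, measure_singleton]

theorem integrable_of_support_subset {u : S.V → ℂ} {E : Finset S.V} (hu : support u ⊆ E) :
    Integrable u S.μ := by
  rw [← integrableOn_iff_integrable_of_support_subset hu]
  exact integrableOn_finset u E

theorem setIntegral_finset {F : Type*} [NormedAddCommGroup F] [NormedSpace ℝ F] [CompleteSpace F]
    (u : S.V → F) (E : Finset S.V) :
    ∫ x in E, u x ∂S.μ = ∑ x ∈ E, S.weight x • u x := by
  rw [MeasureTheory.setIntegral_finset]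
  · exact Finset.sum_congr rfl fun x _ => by rw [measureReal_singleton]
  · exact integrableOn_finset u E

theorem integral_of_support_subset {u : S.V → ℂ} {E : Finset S.V} (hu : support u ⊆ E) :
    ∫ x, u x ∂S.μ = ∑ x ∈ E, (S.weight x : ℂ) * u x := by
  rw [← setIntegral_eq_integral_of_forall_compl_eq_zero (s := (E : Set S.V))
    fun x hx => by_contra fun h => hx (hu h), setIntegral_finset]
  simp

theorem isAtom_top_of_bound (R : S.AdmTrap) {a : S.V → ℂ} (hs : support a ⊆ R.envFinset)
    (hb : ∀ x, ‖a x‖ ≤ (S.mass R.envFinset)⁻¹)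
    (h0 : ∑ x ∈ R.envFinset, (S.weight x : ℂ) * a x = 0) : S.IsAtom ⊤ a := by
  refine ⟨R, by rwa [AdmTrap.coe_envFinset] at hs, ?_, by rw [integral_of_support_subset hs, h0]⟩
  rw [eLpNorm_exponent_top, ← AdmTrap.coe_envFinset, measure_finset]
  refine (eLpNormEssSup_le_of_ae_bound (Eventually.of_forall hb)).trans ?_
  rw [ENNReal.ofReal_inv_of_pos (mass_pos R.envFinset_nonempty)]
  simp [ENNReal.rpow_neg_one]

theorem isAtom_zero (S : HomTreeSetting m) (p : ℝ≥0∞) : S.IsAtom p 0 := by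
  obtain ⟨x⟩ := S.conn.nonempty
  exact ⟨⟨x, 1, le_rfl, true, fun _ => rfl⟩, by simp, by simp, by simp⟩

theorem IsAtom.memLp_one {p : ℝ≥0∞} {a : S.V → ℂ} (ha : S.IsAtom p a) : MemLp a 1 S.μ := by
  obtain ⟨R, hs, -⟩ := ha
  rw [← AdmTrap.coe_envFinset] at hs
  exact memLp_one_iff_integrable.2 (integrable_of_support_subset hs)

/-- Atoms for an exponent are atoms for every smaller exponent. -/
theorem eLpNorm_le_of_exponent_le {p q : ℝ≥0∞} (hpq : p ≤ q) {a : S.V → ℂ}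
    {R : S.AdmTrap} (hs : support a ⊆ R.env)
    (ha : eLpNorm a q S.μ ≤ S.μ R.env ^ ((q⁻¹).toReal - 1)) :
    eLpNorm a p S.μ ≤ S.μ R.env ^ ((p⁻¹).toReal - 1) := by
  have h := eLpNorm_le_eLpNorm_mul_rpow_measure_univ (μ := S.μ.restrict R.env) hpq
    (aestronglyMeasurable_of_vertices a _)
  rw [eLpNorm_restrict_eq_of_support_subset hs, eLpNorm_restrict_eq_of_support_subset hs,
    Measure.restrict_apply_univ] at h
  refine h.trans ((mul_le_mul_left ha _).trans ?_)
  have hpos := mass_pos R.envFinset_nonempty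
  rw [← AdmTrap.coe_envFinset, measure_finset, ← ENNReal.rpow_add _ _
    (by simpa using hpos) ENNReal.ofReal_ne_top, ENNReal.toReal_inv, ENNReal.toReal_inv]
  apply le_of_eq
  congr 1
  ring

theorem IsAtom.eLpNorm_one_le {p : ℝ≥0∞} (hp : 1 ≤ p) {a : S.V → ℂ} (ha : S.IsAtom p a) :
    eLpNorm a 1 S.μ ≤ 1 := by
  obtain ⟨R, hs, hn, -⟩ := ha
  simpa using eLpNorm_le_of_exponent_le hp hs hn

theorem IsAtom.two_of_top {a : S.V → ℂ} (ha : S.IsAtom ⊤ a) : S.IsAtom 2 a := by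
  obtain ⟨R, hs, hn, h0⟩ := ha
  exact ⟨R, hs, eLpNorm_le_of_exponent_le le_top hs hn, h0⟩

theorem IsAtom.exists_sum_sq_le {a : S.V → ℂ} (ha : S.IsAtom 2 a) :
    ∃ R : S.AdmTrap, support a ⊆ R.envFinset ∧
      ∑ x ∈ R.envFinset, (S.weight x : ℂ) * a x = 0 ∧
      ∑ x ∈ R.envFinset, S.weight x * ‖a x‖ ^ 2 ≤ (S.mass R.envFinset)⁻¹ := by
  obtain ⟨R, hs, hn, h0⟩ := ha
  rw [← AdmTrap.coe_envFinset] at hs hn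
  refine ⟨R, hs, by rw [← integral_of_support_subset hs, h0], ?_⟩
  have hpos := mass_pos R.envFinset_nonempty
  have h := ENNReal.rpow_le_rpow hn (z := ((2 : NNReal) : ℝ)) (by positivity)
  rw [← eLpNorm_restrict_eq_of_support_subset hs] at h
  have h2 := eLpNorm_nnreal_pow_eq_lintegral (μ := S.μ.restrict R.envFinset) (f := a)
    (p := 2) two_ne_zero
  rw [ENNReal.coe_ofNat] at h2
  rw [h2, lintegral_finset, measure_finset, ← ENNReal.rpow_mul] at h
  have e : ((2 : ℝ≥0∞)⁻¹.toReal - 1) * ((2 : NNReal) : ℝ) = -1 := by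
    simp; norm_num
  rw [e, ENNReal.rpow_neg_one, ← ENNReal.ofReal_inv_of_pos hpos] at h
  rw [← ENNReal.ofReal_le_ofReal_iff (by positivity),
    ENNReal.ofReal_sum_of_nonneg fun x _ => mul_nonneg (weight_pos x).le (by positivity)]
  refine le_trans (le_of_eq (Finset.sum_congr rfl fun x _ => ?_)) h
  rw [measure_singleton, mul_comm, ENNReal.ofReal_mul (by positivity), ENNReal.ofReal_pow
    (norm_nonneg _), ofReal_norm]
  simp

/-- `u` is a finite linear combination of `(1,∞)`-atoms whose coefficients have total modulus at
most `t`. -/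
def FinDecomp (u : S.V → ℂ) (t : ℝ) : Prop :=
  ∃ (n : ℕ) (c : ℕ → ℂ) (a : ℕ → S.V → ℂ), (∀ j, S.IsAtom ⊤ (a j)) ∧
    (u = fun x => ∑ j ∈ Finset.range n, c j * a j x) ∧ ∑ j ∈ Finset.range n, ‖c j‖ ≤ t

namespace FinDecomp

theorem zero : FinDecomp (0 : S.V → ℂ) 0 :=
  ⟨0, 0, fun _ => 0, fun _ => isAtom_zero S ⊤, by ext; simp, by simp⟩

theorem mono {u : S.V → ℂ} {s t : ℝ} (h : FinDecomp u s) (hst : s ≤ t) : FinDecomp u t := by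
  obtain ⟨n, c, a, ha, hu, hc⟩ := h
  exact ⟨n, c, a, ha, hu, hc.trans hst⟩

theorem add {u v : S.V → ℂ} {s t : ℝ} (hu : FinDecomp u s) (hv : FinDecomp v t) :
    FinDecomp (u + v) (s + t) := by
  obtain ⟨n, c, a, ha, rfl, hc⟩ := hu
  obtain ⟨k, d, b, hb, rfl, hd⟩ := hv
  refine ⟨n + k, fun j => if j < n then c j else d (j - n),
    fun j => if j < n then a j else b (j - n), fun j => ?_, ?_, ?_⟩
  · dsimp only
    split_ifs
    · exact ha j
    · exact hb _
  · ext x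
    rw [Finset.sum_range_add, Pi.add_apply]
    refine congrArg₂ (fun p q : ℂ => p + q) (Finset.sum_congr rfl fun j hj => ?_)
      (Finset.sum_congr rfl fun j _ => ?_)
    · simp [Finset.mem_range.1 hj]
    · simp
  · rw [Finset.sum_range_add]
    refine (add_le_add (le_of_eq (Finset.sum_congr rfl fun j hj => ?_))
      (le_of_eq (Finset.sum_congr rfl fun j _ => ?_))).trans (add_le_add hc hd)
    · simp [Finset.mem_range.1 hj]
    · simp

theorem sum {ι : Type} (s : Finset ι) {u : ι → S.V → ℂ} {t : ι → ℝ}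
    (h : ∀ i ∈ s, FinDecomp (u i) (t i)) : FinDecomp (∑ i ∈ s, u i) (∑ i ∈ s, t i) := by
  classical
  induction s using Finset.induction_on with
  | empty => simpa using zero
  | insert i s hi ih =>
    rw [Finset.sum_insert hi, Finset.sum_insert hi]
    exact (h i (Finset.mem_insert_self i s)).add
      (ih fun j hj => h j (Finset.mem_insert_of_mem hj))

theorem of_bound {u : S.V → ℂ} {M : ℝ} (R : S.AdmTrap) (hs : support u ⊆ R.envFinset)
    (hb : ∀ x, ‖u x‖ ≤ M) (h0 : ∑ x ∈ R.envFinset, (S.weight x : ℂ) * u x = 0) :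
    FinDecomp u (M * S.mass R.envFinset) := by
  have hpos := mass_pos R.envFinset_nonempty
  have hM : 0 ≤ M := by
    obtain ⟨x, -⟩ := R.envFinset_nonempty
    exact (norm_nonneg _).trans (hb x)
  refine ⟨1, fun _ => ((M * S.mass R.envFinset : ℝ) : ℂ),
    fun _ x => ((M * S.mass R.envFinset : ℝ) : ℂ)⁻¹ * u x, fun _ => ?_, ?_, ?_⟩
  · refine isAtom_top_of_bound R (fun x hx => hs fun h => hx (by simp [h])) (fun x => ?_) ?_
    · rw [norm_mul, norm_inv, Complex.norm_real, Real.norm_of_nonneg (by positivity), mul_inv,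
        mul_comm M⁻¹, mul_assoc]
      refine mul_le_of_le_one_right (by positivity) ?_
      rw [inv_mul_eq_div]
      exact div_le_one_of_le₀ (hb x) hM
    · simp only [mul_left_comm _ ((M * S.mass R.envFinset : ℝ) : ℂ)⁻¹]
      rw [← Finset.mul_sum, h0, mul_zero]
  · ext x
    rw [Finset.sum_range_one]
    rcases hM.eq_or_lt with rfl | hM'
    · have := norm_le_zero_iff.1 (hb x)
      simp [this]
    · refine (mul_inv_cancel_left₀ ?_ _).symm
      exact Complex.ofReal_ne_zero.2 (mul_pos hM' hpos).ne'
  · rw [Finset.sum_range_one, Complex.norm_real, Real.norm_of_nonneg (by positivity)]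

end FinDecomp

end Atoms

section CalderonZygmund

variable {m : ℕ} {S : HomTreeSetting m}

theorem Divisible.nonempty_cover {D : ℝ} {Q : Finset S.V} (hQ : Divisible D Q) :
    ∃ R : S.AdmTrap, Q ⊆ R.envFinset ∧ S.mass R.envFinset ≤ 14 * S.mass Q := by
  cases hQ with
  | single x =>
    refine ⟨⟨x, 1, le_rfl, true, fun _ => rfl⟩, ?_⟩
    have := mass_pos (Finset.singleton_nonempty x)
    simp only [AdmTrap.envFinset, if_true]
    exact ⟨subset_rfl, by linarith⟩
  | split _ _ _ _ _ _ cover => exact cover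

/-- `N` bounds the quadratic mean of `u` on `E`. -/
def QuadMeanLE (u : S.V → ℂ) (E : Finset S.V) (N : ℝ) : Prop :=
  ∑ x ∈ E, S.weight x * ‖u x‖ ^ 2 ≤ N ^ 2 * S.mass E

/-- Every function of vanishing integral supported in `Q` has a finite decomposition of cost at
most `C` times the mass of `Q` times its quadratic mean on `Q`. -/
def CostLE (C : ℝ) (Q : Finset S.V) : Prop :=
  ∀ v : S.V → ℂ, support v ⊆ Q → ∑ x ∈ Q, (S.weight x : ℂ) * v x = 0 →
    ∀ N, 0 ≤ N → QuadMeanLE v Q N → FinDecomp v (C * N * S.mass Q)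

theorem norm_sum_sq_le (u : S.V → ℂ) (E : Finset S.V) :
    ‖∑ x ∈ E, (S.weight x : ℂ) * u x‖ ^ 2 ≤
      S.mass E * ∑ x ∈ E, S.weight x * ‖u x‖ ^ 2 := by
  have h1 : ‖∑ x ∈ E, (S.weight x : ℂ) * u x‖ ≤ ∑ x ∈ E, S.weight x * ‖u x‖ := by
    refine (norm_sum_le _ _).trans (le_of_eq (Finset.sum_congr rfl fun x _ => ?_))
    rw [norm_mul, Complex.norm_real, Real.norm_of_nonneg (weight_pos x).le]
  refine (pow_le_pow_left₀ (norm_nonneg _) h1 2).trans ?_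
  refine Finset.sum_sq_le_sum_mul_sum_of_sq_le_mul _ (fun x _ => (weight_pos x).le)
    (fun x _ => mul_nonneg (weight_pos x).le (by positivity)) fun x _ =>
      le_of_eq (by ring)

/-- On a set where the quadratic mean of `u` exceeds `lam` but is at most `B * lam`, the function
`u` is replaced by its mean. -/
theorem exists_good_of_not_quadMeanLE {C B lam : ℝ} (hB : 0 ≤ B) (hl : 0 < lam) {E : Finset S.V}
    {u : S.V → ℂ} (hE : CostLE C E) (hne : E.Nonempty) (hlow : ¬ QuadMeanLE u E lam)
    (hup : QuadMeanLE u E (B * lam)) :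
    ∃ g : S.V → ℂ, support g ⊆ E ∧ (∀ x, ‖g x‖ ≤ B * lam) ∧
      ∑ x ∈ E, (S.weight x : ℂ) * g x = ∑ x ∈ E, (S.weight x : ℂ) * u x ∧
      FinDecomp ((E : Set S.V).indicator u - g)
        (2 * C / lam * ∑ x ∈ E, S.weight x * ‖u x‖ ^ 2) := by
  have hpos := mass_pos hne
  rw [QuadMeanLE] at hlow hup
  push Not at hlow
  set s := ∑ x ∈ E, S.weight x * ‖u x‖ ^ 2 with hs
  set c : ℂ := (∑ x ∈ E, (S.weight x : ℂ) * u x) / S.mass E with hc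
  have hmc : (S.mass E : ℂ) * c = ∑ x ∈ E, (S.weight x : ℂ) * u x := by
    rw [hc, mul_div_cancel₀]
    exact_mod_cast hpos.ne'
  have hcs : S.mass E * ‖c‖ ^ 2 ≤ s := by
    have h := norm_sum_sq_le u E
    rw [← hmc, norm_mul, Complex.norm_real, Real.norm_of_nonneg hpos.le, mul_pow, sq (S.mass E),
      mul_assoc] at h
    exact le_of_mul_le_mul_left h hpos
  have hcB : ‖c‖ ≤ B * lam := by
    refine le_of_sq_le_sq ?_ (by positivity)
    nlinarith
  have hsum : ∑ x ∈ E, (S.weight x : ℂ) * (E : Set S.V).indicator (fun _ => c) x =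
      ∑ x ∈ E, (S.weight x : ℂ) * u x := by
    rw [← hmc, mass, Complex.ofReal_sum, Finset.sum_mul]
    exact Finset.sum_congr rfl fun x hx => by rw [indicator_of_mem (Finset.mem_coe.2 hx)]
  refine ⟨(E : Set S.V).indicator fun _ => c, support_indicator_subset, fun x => ?_, hsum, ?_⟩
  · exact (norm_indicator_le_norm_self _ _).trans hcB
  · refine (hE _ ?_ ?_ (2 * s / (lam * S.mass E)) ?_ ?_).mono (le_of_eq ?_)
    · exact (support_sub _ _).trans
        (union_subset support_indicator_subset support_indicator_subset)
    · simp only [Pi.sub_apply, mul_sub, Finset.sum_sub_distrib]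
      rw [hsum, sub_eq_zero]
      exact Finset.sum_congr rfl fun x hx => by rw [indicator_of_mem (Finset.mem_coe.2 hx)]
    · have : 0 ≤ s := le_trans (by positivity) hlow.le
      positivity
    · rw [QuadMeanLE]
      have h1 : ∑ x ∈ E, S.weight x *
          ‖((E : Set S.V).indicator u - (E : Set S.V).indicator fun _ => c) x‖ ^ 2 ≤
          ∑ x ∈ E, (2 * (S.weight x * ‖u x‖ ^ 2) + 2 * (S.weight x * ‖c‖ ^ 2)) := by
        refine Finset.sum_le_sum fun x hx => ?_
        rw [Pi.sub_apply, indicator_of_mem (Finset.mem_coe.2 hx),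
          indicator_of_mem (Finset.mem_coe.2 hx)]
        have h2 : ‖u x - c‖ ^ 2 ≤ 2 * ‖u x‖ ^ 2 + 2 * ‖c‖ ^ 2 := by
          have := norm_sub_le (u x) c
          nlinarith [norm_nonneg (u x - c), sq_nonneg (‖u x‖ - ‖c‖)]
        have := mul_le_mul_of_nonneg_left h2 (weight_pos x).le
        linarith
      refine h1.trans ?_
      rw [Finset.sum_add_distrib, ← Finset.mul_sum, ← Finset.mul_sum, ← Finset.sum_mul]
      change 2 * s + 2 * (S.mass E * ‖c‖ ^ 2) ≤ _
      have h3 : (2 * s / (lam * S.mass E)) ^ 2 * S.mass E = 4 * s * (s / (lam ^ 2 * S.mass E)) := by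
        field_simp
        ring
      have h4 : 1 ≤ s / (lam ^ 2 * S.mass E) := by
        rw [one_le_div (by positivity)]
        exact hlow.le
      have h5 : 0 ≤ s := le_trans (by positivity) hlow.le
      rw [h3]
      nlinarith
    · field_simp

/-- The Calderón–Zygmund decomposition of `u` on a divisible set, at a height `lam` not exceeded
by its quadratic mean. -/
theorem Divisible.exists_good {C B D lam : ℝ} (hC : 0 ≤ C) (hB : 1 ≤ B) (hD : D ≤ B ^ 2)
    (hl : 0 < lam) (u : S.V → ℂ) {P : Finset S.V} (hP : Divisible D P)
    (hmean : QuadMeanLE u P lam)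
    (hcost : ∀ E ⊆ P, Divisible D E → ¬ QuadMeanLE u E lam → CostLE C E) :
    ∃ g : S.V → ℂ, support g ⊆ P ∧ (∀ x, ‖g x‖ ≤ B * lam) ∧
      ∑ x ∈ P, (S.weight x : ℂ) * g x = ∑ x ∈ P, (S.weight x : ℂ) * u x ∧
      FinDecomp ((P : Set S.V).indicator u - g)
        (2 * C / lam * ∑ x ∈ P, S.weight x * ‖u x‖ ^ 2) := by
  classical
  induction hP with
  | single x =>
    refine ⟨((({x} : Finset S.V)) : Set S.V).indicator u, support_indicator_subset, fun y => ?_,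
      ?_, ?_⟩
    · by_cases hy : y = x
      · subst hy
        simp only [QuadMeanLE, mass, Finset.sum_singleton] at hmean
        have h : ‖u y‖ ^ 2 ≤ lam ^ 2 :=
          le_of_mul_le_mul_left (by linarith) (weight_pos y)
        have h' := le_of_sq_le_sq h hl.le
        simp only [Finset.coe_singleton, mem_singleton_iff, indicator_of_mem]
        nlinarith
      · rw [indicator_of_notMem (by simpa using hy), norm_zero]
        positivity
    · exact Finset.sum_congr rfl fun y hy => by rw [indicator_of_mem (Finset.mem_coe.2 hy)]
    · rw [sub_self]
      refine FinDecomp.zero.mono ?_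
      have := fun y => (weight_pos (S := S) y).le
      exact mul_nonneg (by positivity) (Finset.sum_nonneg fun y _ => mul_nonneg (this y)
        (by positivity))
  | @split Q ι s P mem_iff disj piece mass_le cover ih =>
    have hsub : ∀ i ∈ s, P i ⊆ Q := fun i hi x hx => (mem_iff x).2 ⟨i, hi, hx⟩
    have hQ : Q = s.biUnion P := by ext x; simp [mem_iff]
    have hex : ∀ i ∈ s, ∃ g : S.V → ℂ, support g ⊆ P i ∧ (∀ x, ‖g x‖ ≤ B * lam) ∧
        ∑ x ∈ P i, (S.weight x : ℂ) * g x = ∑ x ∈ P i, (S.weight x : ℂ) * u x ∧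
        FinDecomp ((P i : Set S.V).indicator u - g)
          (2 * C / lam * ∑ x ∈ P i, S.weight x * ‖u x‖ ^ 2) := by
      intro i hi
      by_cases hi' : QuadMeanLE u (P i) lam
      · exact ih i hi hi' fun E hE => hcost E (hE.trans (hsub i hi))
      · have hle : ∑ x ∈ P i, S.weight x * ‖u x‖ ^ 2 ≤ ∑ x ∈ Q, S.weight x * ‖u x‖ ^ 2 :=
          Finset.sum_le_sum_of_subset_of_nonneg (hsub i hi)
            fun x _ _ => mul_nonneg (weight_pos x).le (by positivity)
        refine exists_good_of_not_quadMeanLE (by positivity) hl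
          (hcost _ (hsub i hi) (piece i hi) hi') ?_ hi' ?_
        · rw [Finset.nonempty_iff_ne_empty]
          intro h0
          rw [h0] at hi'
          exact hi' (by simp [QuadMeanLE, mass])
        · refine hle.trans (hmean.trans ?_)
          rw [mul_pow, mul_comm (B ^ 2), mul_assoc]
          refine mul_le_mul_of_nonneg_left ((mass_le i hi).trans ?_) (by positivity)
          exact mul_le_mul_of_nonneg_right hD (mass_nonneg _)
    choose! g hg using hex
    have hzero : ∀ i ∈ s, ∀ x, x ∉ P i → g i x = 0 := fun i hi x hx =>
      by_contra fun h => hx ((hg i hi).1 h)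
    refine ⟨∑ i ∈ s, g i, ?_, ?_, ?_, ?_⟩
    · intro x hx
      rw [mem_support, Finset.sum_apply] at hx
      obtain ⟨i, hi, hx⟩ := Finset.exists_ne_zero_of_sum_ne_zero hx
      exact hsub i hi ((hg i hi).1 hx)
    · intro x
      rw [Finset.sum_apply]
      by_cases hx : ∃ i ∈ s, x ∈ P i
      · obtain ⟨i, hi, hx⟩ := hx
        rw [Finset.sum_eq_single_of_mem i hi]
        · exact (hg i hi).2.1 x
        · intro j hj hji
          exact hzero j hj x fun hx' => Finset.disjoint_left.1 (disj hj hi hji) hx' hx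
      · push Not at hx
        rw [Finset.sum_eq_zero fun i hi => hzero i hi x (hx i hi), norm_zero]
        positivity
    · rw [hQ, Finset.sum_biUnion disj, Finset.sum_biUnion disj]
      refine Finset.sum_congr rfl fun i hi => ?_
      rw [← (hg i hi).2.2.1]
      refine Finset.sum_congr rfl fun x hx => ?_
      rw [Finset.sum_apply, Finset.sum_eq_single_of_mem i hi]
      intro j hj hji
      exact hzero j hj x fun hx' => Finset.disjoint_left.1 (disj hj hi hji) hx' hx
    · have h := FinDecomp.sum s fun i hi => (hg i hi).2.2.2
      rw [← Finset.mul_sum, ← Finset.sum_biUnion disj, ← hQ, Finset.sum_sub_distrib] at h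
      convert h using 2
      have hd : (s : Set ι).PairwiseDisjoint fun i => (P i : Set S.V) :=
        fun i hi j hj hij => Finset.disjoint_coe.2 (disj hi hj hij)
      have := Finset.indicator_biUnion s (fun i => (P i : Set S.V)) (f := u) hd
      rw [hQ, Finset.coe_biUnion]
      simp only [Finset.mem_coe]
      rw [this]
      ext x
      simp

theorem Divisible.costLE {B D : ℝ} (hB : 1 ≤ B) (hD : D ≤ B ^ 2) {Q : Finset S.V}
    (hQ : Divisible D Q) : CostLE (112 * B) Q := by
  induction hn : Q.card using Nat.strong_induction_on generalizing Q with
  | _ n ih =>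
    subst hn
    intro v hs h0 N hN hv
    rcases hN.eq_or_lt with rfl | hN
    · have hv0 : v = 0 := by
        ext x
        by_contra hx
        have hxQ : x ∈ Q := hs hx
        have h1 := Finset.single_le_sum (f := fun x => S.weight x * ‖v x‖ ^ 2)
          (fun y _ => mul_nonneg (weight_pos y).le (by positivity)) hxQ
        have h2 : 0 < S.weight x * ‖v x‖ ^ 2 :=
          mul_pos (weight_pos x) (pow_pos (norm_pos_iff.2 hx) 2)
        rw [QuadMeanLE] at hv
        linarith
      rw [hv0]
      exact FinDecomp.zero.mono (by simp)
    have hmass := mass_nonneg Q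
    have hmean : QuadMeanLE v Q (4 * N) := by
      refine hv.trans (mul_le_mul_of_nonneg_right ?_ hmass)
      nlinarith
    obtain ⟨g, hgs, hgb, hg0, hgd⟩ := hQ.exists_good (C := 112 * B) (by positivity) hB hD
      (lam := 4 * N) (by positivity) v hmean fun E hE hEd hEm =>
        ih E.card (Finset.card_lt_card (hE.ssubset_of_ne fun h => hEm (h ▸ hmean))) hEd rfl
    obtain ⟨R, hR, hRm⟩ := hQ.nonempty_cover
    have hg := FinDecomp.of_bound R (hgs.trans (Finset.coe_subset.2 hR)) hgb (by
      rw [← h0, ← hg0]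
      refine (Finset.sum_subset hR fun x _ hx => ?_).symm
      rw [by_contra fun h => hx (hgs h), mul_zero])
    have h := hgd.add hg
    rw [indicator_eq_self.2 hs, sub_add_cancel] at h
    refine h.mono ?_
    have h1 : 2 * (112 * B) / (4 * N) * ∑ x ∈ Q, S.weight x * ‖v x‖ ^ 2 ≤
        2 * (112 * B) / (4 * N) * (N ^ 2 * S.mass Q) :=
      mul_le_mul_of_nonneg_left hv (by positivity)
    have h2 : 2 * (112 * B) / (4 * N) * (N ^ 2 * S.mass Q) = 56 * B * N * S.mass Q := by
      field_simp
      ring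
    have h3 : B * (4 * N) * S.mass R.envFinset ≤ B * (4 * N) * (14 * S.mass Q) :=
      mul_le_mul_of_nonneg_left hRm (by positivity)
    linarith

/-- The constant bounding the cost of decomposing a `(1,2)`-atom into `(1,∞)`-atoms. -/
noncomputable def atomConst (m : ℕ) : ℝ := 112 * (7 * m)

theorem two_le_atomConst (S : HomTreeSetting m) : 2 ≤ atomConst m := by
  have h : (1 : ℝ) ≤ m := by exact_mod_cast (by have := S.hm; omega : 1 ≤ m)
  rw [atomConst]
  linarith

theorem IsAtom.finDecomp {a : S.V → ℂ} (ha : S.IsAtom 2 a) : FinDecomp a (atomConst m) := by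
  obtain ⟨R, hs, h0, hq⟩ := ha.exists_sum_sq_le
  have hpos := mass_pos R.envFinset_nonempty
  have hm1 : (1 : ℝ) ≤ m := by exact_mod_cast (by have := S.hm; omega : 1 ≤ m)
  refine ((divisible_envFinset R).costLE (B := 7 * m) (by linarith) (by nlinarith) a hs h0
    (S.mass R.envFinset)⁻¹ (by positivity) (hq.trans (le_of_eq ?_))).mono (le_of_eq ?_)
  · field_simp
  · rw [atomConst]
    field_simp

end CalderonZygmund

section HardySpace

variable {m : ℕ} {S : HomTreeSetting m}

theorem norm_smul_toLp_le {p : ℝ≥0∞} (hp : 1 ≤ p) (c : ℂ) {a : S.V → ℂ} (ha : S.IsAtom p a) :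
    ‖c • ha.memLp_one.toLp a‖ ≤ ‖c‖ := by
  rw [norm_smul, Lp.norm_toLp]
  refine mul_le_of_le_one_right (norm_nonneg c) ?_
  simpa using ENNReal.toReal_mono ENNReal.one_ne_top (ha.eLpNorm_one_le hp)

/-- Convergence of an atomic decomposition in terms of sums in the Banach space `L¹(μ)`. -/
theorem isAtomicDecomp_iff_hasSum {p : ℝ≥0∞} (hp : 1 ≤ p) {f : S.V → ℂ} (hf : MemLp f 1 S.μ)
    {c : ℕ → ℂ} {a : ℕ → S.V → ℂ} (ha : ∀ j, S.IsAtom p (a j)) (hc : Summable fun j => ‖c j‖) :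
    S.IsAtomicDecomp p f c a ↔
      HasSum (fun j => c j • (ha j).memLp_one.toLp (a j)) (hf.toLp f) := by
  have hsum (n : ℕ) : ∃ h : MemLp (fun x => ∑ j ∈ Finset.range n, c j * a j x) 1 S.μ,
      ∑ j ∈ Finset.range n, c j • (ha j).memLp_one.toLp (a j) = h.toLp _ := by
    induction n with
    | zero => exact ⟨by simp, by simp; rfl⟩
    | succ n ih =>
      obtain ⟨h, hn⟩ := ih
      simp only [Finset.sum_range_succ]
      exact ⟨h.add ((ha n).memLp_one.const_mul (c n)), by rw [hn]; rfl⟩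
  choose h hh using hsum
  have hs : Summable fun j => c j • (ha j).memLp_one.toLp (a j) :=
    .of_norm_bounded hc fun j => norm_smul_toLp_le hp _ (ha j)
  rw [hs.hasSum_iff_tendsto_nat]
  simp only [hh]
  rw [Lp.tendsto_Lp_iff_tendsto_eLpNorm'']
  have he (n : ℕ) : eLpNorm ((fun x => ∑ j ∈ Finset.range n, c j * a j x) - f) 1 S.μ =
      eLpNorm (fun x => f x - ∑ j ∈ Finset.range n, c j * a j x) 1 S.μ :=
    eLpNorm_sub_comm _ _ _ _
  simp only [he]
  exact ⟨fun H => H.2.2, fun H => ⟨ha, hc, H⟩⟩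

theorem FinDecomp.exists_isAtomicDecomp {u : S.V → ℂ} {t : ℝ} (h : FinDecomp u t) :
    ∃ c a, S.IsAtomicDecomp ⊤ u c a ∧ ∑' j, ‖c j‖ ≤ t := by
  obtain ⟨n, c, a, ha, hu, hc⟩ := h
  have h0 : ∀ j ∉ Finset.range n, ‖(Finset.range n : Set ℕ).indicator c j‖ = 0 := fun j hj => by
    rw [indicator_of_notMem (by exact_mod_cast hj), norm_zero]
  refine ⟨(Finset.range n : Set ℕ).indicator c, a, ⟨ha, summable_of_ne_finset_zero h0, ?_⟩, ?_⟩
  · refine tendsto_const_nhds.congr' ?_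
    filter_upwards [eventually_ge_atTop n] with N hN
    symm
    rw [eLpNorm_eq_zero_of_ae_zero]
    refine Eventually.of_forall fun x => ?_
    rw [hu, Pi.zero_apply, sub_eq_zero]
    rw [← Finset.sum_subset (Finset.range_subset_range.2 hN) fun j _ hj => by
      rw [norm_eq_zero.1 (h0 j hj), zero_mul]]
    exact Finset.sum_congr rfl fun j hj => by rw [indicator_of_mem (by exact_mod_cast hj)]
  · rw [tsum_eq_sum h0]
    refine le_trans (le_of_eq (Finset.sum_congr rfl fun j hj => ?_)) hc
    rw [indicator_of_mem (by exact_mod_cast hj)]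

/-- Every decomposition into `(1,2)`-atoms can be refined to one into `(1,∞)`-atoms. -/
theorem IsAtomicDecomp.exists_top {f : S.V → ℂ} (hf : Integrable f S.μ) {c : ℕ → ℂ}
    {a : ℕ → S.V → ℂ} (h : S.IsAtomicDecomp 2 f c a) :
    ∃ d b, S.IsAtomicDecomp ⊤ f d b ∧ ∑' j, ‖d j‖ ≤ atomConst m * ∑' j, ‖c j‖ := by
  have hf1 := memLp_one_iff_integrable.2 hf
  have ha := h.1
  have hc := h.2.1
  have H := (isAtomicDecomp_iff_hasSum one_le_two hf1 ha hc).1 h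
  choose d b hdb hd using fun j => (ha j).finDecomp.exists_isAtomicDecomp
  have hb (j k : ℕ) : S.IsAtom ⊤ (b j k) := (hdb j).1 k
  have Hj (j : ℕ) : HasSum (fun k => d j k • (hb j k).memLp_one.toLp (b j k))
      ((ha j).memLp_one.toLp (a j)) :=
    (isAtomicDecomp_iff_hasSum le_top _ (hb j) (hdb j).2.1).1 (hdb j)
  have hsum : Summable fun q : ℕ × ℕ => ‖c q.1 * d q.1 q.2‖ := by
    rw [summable_prod_of_nonneg fun _ => norm_nonneg _]
    simp only [norm_mul, tsum_mul_left]
    refine ⟨fun j => (hdb j).2.1.mul_left _, (hc.mul_right (atomConst m)).of_nonneg_of_le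
      (fun j => mul_nonneg (norm_nonneg _) (tsum_nonneg fun _ => norm_nonneg _))
      fun j => mul_le_mul_of_nonneg_left (hd j) (norm_nonneg _)⟩
  have hle : ∑' q : ℕ × ℕ, ‖c q.1 * d q.1 q.2‖ ≤ atomConst m * ∑' j, ‖c j‖ := by
    rw [hsum.tsum_prod, mul_comm, ← tsum_mul_right]
    refine hsum.prod.tsum_le_tsum (fun j => ?_) (hc.mul_right _)
    simp only [norm_mul, tsum_mul_left]
    exact mul_le_mul_of_nonneg_left (hd j) (norm_nonneg _)
  have hs : Summable fun q : ℕ × ℕ =>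
      (c q.1 * d q.1 q.2) • (hb q.1 q.2).memLp_one.toLp (b q.1 q.2) :=
    .of_norm_bounded hsum fun q => norm_smul_toLp_le le_top _ (hb q.1 q.2)
  have hS : HasSum (fun q : ℕ × ℕ =>
      (c q.1 * d q.1 q.2) • (hb q.1 q.2).memLp_one.toLp (b q.1 q.2)) (hf1.toLp f) := by
    have h1 := hs.hasSum.prod_fiberwise fun j => by
      simpa only [mul_smul] using (Hj j).const_smul (c j)
    rw [H.unique h1]
    exact hs.hasSum
  obtain ⟨e⟩ : Nonempty (ℕ ≃ ℕ × ℕ) := ⟨Nat.pairEquiv.symm⟩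
  refine ⟨fun i => c (e i).1 * d (e i).1 (e i).2, fun i => b (e i).1 (e i).2, ?_, ?_⟩
  · exact (isAtomicDecomp_iff_hasSum le_top hf1 (fun i => hb (e i).1 (e i).2)
      (e.summable_iff.2 hsum)).2 (e.hasSum_iff.2 hS)
  · rw [e.tsum_eq fun q : ℕ × ℕ => ‖c q.1 * d q.1 q.2‖]
    exact hle

theorem h1Norm_le {p : ℝ≥0∞} {f : S.V → ℂ} {c : ℕ → ℂ} {a : ℕ → S.V → ℂ}
    (h : S.IsAtomicDecomp p f c a) : S.h1Norm p f ≤ ∑' j, ‖c j‖ := by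
  refine csInf_le ⟨0, ?_⟩ ⟨c, a, h, rfl⟩
  rintro _ ⟨c, a, -, rfl⟩
  exact tsum_nonneg fun _ => norm_nonneg _

theorem IsAtomicDecomp.two_of_top {f : S.V → ℂ} {c : ℕ → ℂ} {a : ℕ → S.V → ℂ}
    (h : S.IsAtomicDecomp ⊤ f c a) : S.IsAtomicDecomp 2 f c a :=
  ⟨fun j => (h.1 j).two_of_top, h.2⟩

theorem h1Norm_two_le_top {f : S.V → ℂ} (h : S.MemH1 2 f) : S.h1Norm 2 f ≤ S.h1Norm ⊤ f := by
  obtain ⟨hf, c, a, h⟩ := h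
  obtain ⟨d, b, hd, -⟩ := h.exists_top hf
  refine le_csInf ⟨_, d, b, hd, rfl⟩ ?_
  rintro _ ⟨c, a, h, rfl⟩
  exact h1Norm_le h.two_of_top

theorem h1Norm_top_le_two {f : S.V → ℂ} (h : S.MemH1 2 f) :
    S.h1Norm ⊤ f ≤ atomConst m * S.h1Norm 2 f := by
  obtain ⟨hf, c, a, h⟩ := h
  have hpos : 0 < atomConst m := by linarith [two_le_atomConst S]
  rw [← div_le_iff₀' hpos]
  refine le_csInf ⟨_, c, a, h, rfl⟩ ?_
  rintro _ ⟨c, a, h, rfl⟩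
  obtain ⟨d, b, hd, hle⟩ := h.exists_top hf
  rw [div_le_iff₀' hpos]
  exact (h1Norm_le hd).trans hle

theorem FinDecomp.memH1 {u : S.V → ℂ} {t : ℝ} (h : FinDecomp u t) : S.MemH1 ⊤ u := by
  obtain ⟨c, a, hd, -⟩ := h.exists_isAtomicDecomp
  obtain ⟨n, c', a', ha', rfl, -⟩ := h
  refine ⟨integrable_finsetSum _ fun j _ => ?_, c, a, hd⟩
  exact (memLp_one_iff_integrable.1 (ha' j).memLp_one).const_mul (c' j)

theorem FinDecomp.h1Norm_le {u : S.V → ℂ} {t : ℝ} (h : FinDecomp u t) : S.h1Norm ⊤ u ≤ t := by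
  obtain ⟨c, a, hd, hle⟩ := h.exists_isAtomicDecomp
  exact (HomTreeSetting.h1Norm_le hd).trans hle

theorem FinDecomp.memH1fin {u : S.V → ℂ} {t : ℝ} (h : FinDecomp u t) : S.MemH1fin ⊤ u := by
  obtain ⟨n, c, a, ha, hu, -⟩ := h
  exact ⟨n, c, a, fun j _ => ha j, hu⟩

theorem FinDecomp.smul {u : S.V → ℂ} {t : ℝ} (h : FinDecomp u t) (r : ℂ) :
    FinDecomp (r • u) (‖r‖ * t) := by
  obtain ⟨n, c, a, ha, rfl, hc⟩ := h
  refine ⟨n, fun j => r * c j, a, ha, ?_, ?_⟩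
  · ext x
    simp [Finset.mul_sum, mul_assoc]
  · simp only [norm_mul, ← Finset.mul_sum]
    exact mul_le_mul_of_nonneg_left hc (norm_nonneg r)

/-- Finite linear combinations of atoms are finitely supported and have integral zero. -/
theorem MemH1fin.exists_support_subset {g : S.V → ℂ} (h : S.MemH1fin ⊤ g) :
    ∃ F : Finset S.V, support g ⊆ F ∧ ∑ x ∈ F, (S.weight x : ℂ) * g x = 0 := by
  classical
  obtain ⟨n, c, a, ha, rfl⟩ := h
  induction n with
  | zero => exact ⟨∅, by simp, by simp⟩
  | succ n ih =>
    obtain ⟨F, hF, h0⟩ := ih fun j hj => ha j (hj.trans n.lt_succ_self)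
    obtain ⟨R, hs, -, hi⟩ := ha n n.lt_succ_self
    rw [← AdmTrap.coe_envFinset] at hs
    have key {u : S.V → ℂ} {E E' : Finset S.V} (hE : support u ⊆ E) (hEE' : E ⊆ E') :
        ∑ x ∈ E', (S.weight x : ℂ) * u x = ∫ x, u x ∂S.μ :=
      (integral_of_support_subset (hE.trans (Finset.coe_subset.2 hEE'))).symm
    refine ⟨F ∪ R.envFinset, ?_, ?_⟩
    · simp only [Finset.sum_range_succ]
      refine (support_add _ _).trans ?_
      rw [Finset.coe_union]
      exact union_subset_union hF fun x hx => hs fun h => hx (by simp [h])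
    · simp only [Finset.sum_range_succ, mul_add, Finset.sum_add_distrib]
      rw [key hF Finset.subset_union_left, (integral_of_support_subset hF).trans h0, zero_add]
      simp only [mul_left_comm _ (c n), ← Finset.mul_sum]
      rw [key hs Finset.subset_union_right, hi, mul_zero]

end HardySpace

section Duality

variable {m : ℕ} {S : HomTreeSetting m}

theorem exists_mem_envFinset (x y : S.V) :
    ∃ R : S.AdmTrap, x ∈ R.envFinset ∧ y ∈ R.envFinset := by
  obtain ⟨i, j, h⟩ := S.exists_common_ancestor x y
  let k := i + j + 1
  let R : S.AdmTrap := ⟨S.parent^[k + i] x, k, by omega, false, by simp⟩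
  have hx := (S.iterate_parent_eq_iff (k + i) x R.root).1 rfl
  have hy := (S.iterate_parent_eq_iff (k + j) y R.root).1 (by
    rw [iterate_add_apply, ← h, ← iterate_add_apply])
  have hk : (R.ht : ℤ) = i + j + 1 := by simp [R, k]
  refine ⟨R, ?_, ?_⟩ <;> rw [← Finset.mem_coe, AdmTrap.coe_envFinset, AdmTrap.env,
    if_neg (by simp [R]), mem_ofPred_eq]
  · exact ⟨hx.1, by rw [hx.2, hk]; push_cast; omega, by rw [hx.2, hk]; push_cast; omega⟩
  · exact ⟨hy.1, by rw [hy.2, hk]; push_cast; omega, by rw [hy.2, hk]; push_cast; omega⟩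

open Classical in
/-- The normalized point mass at `x` minus the normalized point mass at `o`. -/
noncomputable def dipole (S : HomTreeSetting m) (o x : S.V) : S.V → ℂ :=
  Pi.single x (S.weight x : ℂ)⁻¹ - Pi.single o (S.weight o : ℂ)⁻¹

open Classical in
theorem sum_weight_mul_single {x : S.V} {E : Finset S.V} (hx : x ∈ E) (v : S.V → ℂ) :
    ∑ z ∈ E, (S.weight z : ℂ) * (v z * (Pi.single x (S.weight x : ℂ)⁻¹ : S.V → ℂ) z) = v x := by
  have hw : (S.weight x : ℂ) ≠ 0 := Complex.ofReal_ne_zero.2 (weight_pos x).ne'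
  rw [Finset.sum_eq_single_of_mem x hx fun z _ hz => by rw [Pi.single_eq_of_ne hz]; simp,
    Pi.single_eq_same]
  field_simp

theorem sum_weight_mul_dipole {o x : S.V} {E : Finset S.V} (ho : o ∈ E) (hx : x ∈ E)
    (v : S.V → ℂ) :
    ∑ z ∈ E, (S.weight z : ℂ) * (v z * S.dipole o x z) = v x - v o := by
  simp only [dipole, Pi.sub_apply, mul_sub, Finset.sum_sub_distrib, sum_weight_mul_single ho,
    sum_weight_mul_single hx]

theorem support_dipole_subset {o x : S.V} {E : Finset S.V} (ho : o ∈ E) (hx : x ∈ E) :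
    support (S.dipole o x) ⊆ E := by
  intro z hz
  by_contra h
  refine hz ?_
  have h1 : z ≠ x := fun e => h (e ▸ hx)
  have h2 : z ≠ o := fun e => h (e ▸ ho)
  simp [dipole, h1, h2]

theorem exists_finDecomp_dipole (o x : S.V) : ∃ t, FinDecomp (S.dipole o x) t := by
  obtain ⟨R, ho, hx⟩ := exists_mem_envFinset o x
  refine ⟨_, FinDecomp.of_bound (M := ∑ z ∈ R.envFinset, ‖S.dipole o x z‖) R
    (support_dipole_subset ho hx) (fun z => ?_) ?_⟩
  · by_cases hz : z ∈ R.envFinset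
    · exact Finset.single_le_sum (f := fun z => ‖S.dipole o x z‖) (fun _ _ => norm_nonneg _) hz
    · rw [notMem_support.1 fun h => hz (support_dipole_subset ho hx h), norm_zero]
      exact Finset.sum_nonneg fun _ _ => norm_nonneg _
  · simpa using sum_weight_mul_dipole ho hx fun _ => 1

theorem integral_mul_dipole (v : S.V → ℂ) (o x : S.V) :
    ∫ z, v z * S.dipole o x z ∂S.μ = v x - v o := by
  obtain ⟨R, ho, hx⟩ := exists_mem_envFinset o x
  rw [integral_of_support_subset (E := R.envFinset) fun z hz =>
    support_dipole_subset ho hx fun h => hz (by simp [h]), sum_weight_mul_dipole ho hx]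

theorem eq_sum_dipole (o : S.V) {g : S.V → ℂ} {F : Finset S.V} (hF : support g ⊆ F)
    (h0 : ∑ x ∈ F, (S.weight x : ℂ) * g x = 0) :
    g = ∑ x ∈ F, ((S.weight x : ℂ) * g x) • S.dipole o x := by
  classical
  simp only [dipole, smul_sub, Finset.sum_sub_distrib]
  rw [← Finset.sum_smul, h0, zero_smul, sub_zero]
  ext z
  rw [Finset.sum_apply]
  simp only [Pi.smul_apply, Pi.single_apply, smul_eq_mul, mul_ite, mul_zero]
  rw [Finset.sum_ite_eq]
  have hw : (S.weight z : ℂ) ≠ 0 := Complex.ofReal_ne_zero.2 (weight_pos z).ne'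
  split_ifs with hz
  · field_simp
  · exact notMem_support.1 fun h => hz (hF h)

theorem map_sum_smul_of_finDecomp
    {L : (S.V → ℂ) → ℂ}
    (hadd : ∀ g₁ g₂ : S.V → ℂ, S.MemH1 ⊤ g₁ → S.MemH1 ⊤ g₂ → L (g₁ + g₂) = L g₁ + L g₂)
    (hsmul : ∀ (c : ℂ) (g : S.V → ℂ), S.MemH1 ⊤ g → L (c • g) = c * L g)
    {ι : Type} (s : Finset ι) (r : ι → ℂ) {u : ι → S.V → ℂ}
    (hu : ∀ i, ∃ t, FinDecomp (u i) t) :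
    L (∑ i ∈ s, r i • u i) = ∑ i ∈ s, r i * L (u i) := by
  classical
  choose t ht using hu
  induction s using Finset.induction_on with
  | empty => simpa using hsmul 0 0 FinDecomp.zero.memH1
  | insert i s hi ih =>
    rw [Finset.sum_insert hi, Finset.sum_insert hi, hadd _ _ ((ht i).smul (r i)).memH1
      (FinDecomp.sum s fun j _ => (ht j).smul (r j)).memH1, hsmul _ _ (ht i).memH1, ih]

/-- On finite combinations of atoms, a linear functional is the integral against its values on
dipoles. -/
theorem eq_integral_of_memH1fin
    {L : (S.V → ℂ) → ℂ}
    (hadd : ∀ g₁ g₂ : S.V → ℂ, S.MemH1 ⊤ g₁ → S.MemH1 ⊤ g₂ → L (g₁ + g₂) = L g₁ + L g₂)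
    (hsmul : ∀ (c : ℂ) (g : S.V → ℂ), S.MemH1 ⊤ g → L (c • g) = c * L g)
    (o : S.V) {g : S.V → ℂ} (hg : S.MemH1fin ⊤ g) :
    L g = ∫ x, L (S.dipole o x) * g x ∂S.μ := by
  obtain ⟨F, hF, h0⟩ := hg.exists_support_subset
  rw [integral_of_support_subset (E := F) fun x hx => hF fun h => hx (by simp [h])]
  conv_lhs => rw [eq_sum_dipole o hF h0]
  rw [map_sum_smul_of_finDecomp hadd hsmul F _ (exists_finDecomp_dipole o)]
  exact Finset.sum_congr rfl fun x _ => by ring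

theorem osc_one_envFinset (f : S.V → ℂ) (R : S.AdmTrap) :
    S.osc 1 f R.env = (S.mass R.envFinset)⁻¹ *
      ∑ x ∈ R.envFinset, S.weight x * ‖f x - S.avg f R.env‖ := by
  have hpos := mass_pos R.envFinset_nonempty
  rw [osc, ← AdmTrap.coe_envFinset, setIntegral_finset, measure_finset,
    ENNReal.toReal_ofReal hpos.le]
  simp

theorem sum_weight_mul_sub_avg (f : S.V → ℂ) (R : S.AdmTrap) :
    ∑ x ∈ R.envFinset, (S.weight x : ℂ) * (f x - S.avg f R.env) = 0 := by
  have hpos := mass_pos R.envFinset_nonempty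
  have hne : (S.mass R.envFinset : ℂ) ≠ 0 := Complex.ofReal_ne_zero.2 hpos.ne'
  rw [avg, ← AdmTrap.coe_envFinset, setIntegral_finset, measure_finset,
    ENNReal.toReal_ofReal hpos.le]
  simp only [mul_sub, Finset.sum_sub_distrib, ← Finset.sum_mul, Complex.real_smul]
  rw [← Complex.ofReal_sum, ← mass, Complex.ofReal_inv, mul_inv_cancel_left₀ hne, sub_self]

/-- The mean oscillation of `f` on a Calderón–Zygmund set is attained by testing `f` against a
bounded function of mean zero. -/
theorem exists_test_function (f : S.V → ℂ) (R : S.AdmTrap) :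
    ∃ v : S.V → ℂ, FinDecomp v (2 * S.mass R.envFinset) ∧
      ∫ x, f x * v x ∂S.μ = (S.mass R.envFinset * S.osc 1 f R.env : ℝ) := by
  set E := R.envFinset with hE
  have hpos := mass_pos R.envFinset_nonempty
  rw [← hE] at hpos
  have hne : (S.mass E : ℂ) ≠ 0 := Complex.ofReal_ne_zero.2 hpos.ne'
  set A := S.avg f R.env with hA
  let φ : S.V → ℂ := fun x => (starRingEnd ℂ) (f x - A) / ‖f x - A‖
  have hφ1 (x : S.V) : ‖φ x‖ ≤ 1 := by
    rw [norm_div, RCLike.norm_conj, Complex.norm_real, norm_norm]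
    exact div_self_le_one _
  have hφ (x : S.V) : (f x - A) * φ x = ‖f x - A‖ := by
    rcases eq_or_ne (f x - A) 0 with h | h
    · simp [h]
    · have h' : (‖f x - A‖ : ℂ) ≠ 0 := by simpa using h
      rw [← mul_div_assoc, Complex.mul_conj', sq, mul_div_cancel_right₀ _ h']
  set Φ : ℂ := (∑ x ∈ E, (S.weight x : ℂ) * φ x) / S.mass E with hΦdef
  have hΦ : ‖Φ‖ ≤ 1 := by
    rw [norm_div, Complex.norm_real, Real.norm_of_nonneg hpos.le, div_le_one hpos, mass]
    refine norm_sum_le_of_le _ fun x _ => ?_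
    rw [norm_mul, Complex.norm_real, Real.norm_of_nonneg (weight_pos x).le]
    exact mul_le_of_le_one_right (weight_pos x).le (hφ1 x)
  have hmean : ∑ x ∈ E, (S.weight x : ℂ) * (φ x - Φ) = 0 := by
    simp only [mul_sub, Finset.sum_sub_distrib, ← Finset.sum_mul]
    rw [← Complex.ofReal_sum, ← mass, hΦdef, mul_div_cancel₀ _ hne, sub_self]
  have hv : support ((E : Set S.V).indicator fun x => φ x - Φ) ⊆ E := support_indicator_subset
  have hind : ∀ x ∈ E, (E : Set S.V).indicator (fun x => φ x - Φ) x = φ x - Φ :=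
    fun x hx => indicator_of_mem (Finset.mem_coe.2 hx) _
  refine ⟨(E : Set S.V).indicator fun x => φ x - Φ, FinDecomp.of_bound R hv (fun x => ?_) ?_, ?_⟩
  · refine (norm_indicator_le_norm_self _ _).trans ((norm_sub_le _ _).trans ?_)
    linarith [hφ1 x]
  · rw [← hmean]
    exact Finset.sum_congr rfl fun x hx => by rw [hind x hx]
  · rw [integral_of_support_subset (E := E) fun x hx => hv fun h => hx (by simp [h]),
      osc_one_envFinset, mul_inv_cancel_left₀ hpos.ne']
    have h1 : ∀ x ∈ E, (S.weight x : ℂ) * (f x * (E : Set S.V).indicator (fun x => φ x - Φ) x) =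
        (S.weight x * ‖f x - A‖ : ℝ) - Φ * ((S.weight x : ℂ) * (f x - A)) +
          A * ((S.weight x : ℂ) * (φ x - Φ)) := fun x hx => by
      rw [hind x hx, Complex.ofReal_mul, ← hφ x]
      ring
    rw [Finset.sum_congr rfl h1, Finset.sum_add_distrib, Finset.sum_sub_distrib, ← Finset.mul_sum,
      ← Finset.mul_sum, hmean, sum_weight_mul_sub_avg f R, mul_zero, mul_zero, sub_zero,
      add_zero, Complex.ofReal_sum]

end Duality

end HomTreeSetting

/-- Every bounded linear functional `L` on `H^1(μ)` (with bound
`K`, i.e. `‖L g‖ ≤ K ‖g‖_{H^1}`) is represented by a function `f ∈ BMO_1(μ)`,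
unique modulo additive constants, with `L(g) = ∫ f g dμ` on `H^{1,∞}_fin(μ)` and
`‖f‖_{BMO_1} ≤ C₂ K`, where `C₂` is the constant of the equivalence of the
`H^{1,2}` and `H^{1,∞}` norms. -/
theorem functional_on_H1_is_bmo (m : ℕ) (S : HomTreeSetting m) :
    ∃ C₂ : ℝ, 0 < C₂ ∧
      (∀ f : S.V → ℂ, S.MemH1 2 f →
        S.h1Norm 2 f ≤ S.h1Norm ⊤ f ∧ S.h1Norm ⊤ f ≤ C₂ * S.h1Norm 2 f) ∧
      ∀ (L : (S.V → ℂ) → ℂ) (K : ℝ), 0 ≤ K →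
        (∀ g₁ g₂ : S.V → ℂ, S.MemH1 ⊤ g₁ → S.MemH1 ⊤ g₂ →
          L (g₁ + g₂) = L g₁ + L g₂) →
        (∀ (c : ℂ) (g : S.V → ℂ), S.MemH1 ⊤ g → L (c • g) = c * L g) →
        (∀ g : S.V → ℂ, S.MemH1 ⊤ g → ‖L g‖ ≤ K * S.h1Norm ⊤ g) →
        ∃ f : S.V → ℂ, S.MemBMO 1 f ∧
          (∀ g : S.V → ℂ, S.MemH1fin ⊤ g → L g = ∫ x, f x * g x ∂S.μ) ∧
          S.bmoNorm 1 f ≤ C₂ * K ∧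
          ∀ f' : S.V → ℂ, S.MemBMO 1 f' →
            (∀ g : S.V → ℂ, S.MemH1fin ⊤ g → L g = ∫ x, f' x * g x ∂S.μ) →
            ∃ c : ℂ, ∀ x, f' x = f x + c := by
  have hC := HomTreeSetting.two_le_atomConst S
  refine ⟨HomTreeSetting.atomConst m, by linarith, fun f hf =>
    ⟨HomTreeSetting.h1Norm_two_le_top hf, HomTreeSetting.h1Norm_top_le_two hf⟩, ?_⟩
  intro L K hK hadd hsmul hbound
  obtain ⟨o⟩ := S.conn.nonempty
  let f : S.V → ℂ := fun x => L (S.dipole o x)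
  have hf (g : S.V → ℂ) (hg : S.MemH1fin ⊤ g) : L g = ∫ x, f x * g x ∂S.μ :=
    HomTreeSetting.eq_integral_of_memH1fin hadd hsmul o hg
  have hosc (R : S.AdmTrap) : S.osc 1 f R.env ≤ HomTreeSetting.atomConst m * K := by
    have hpos := HomTreeSetting.mass_pos R.envFinset_nonempty
    obtain ⟨v, hv, hint⟩ := HomTreeSetting.exists_test_function f R
    have h := (hbound v hv.memH1).trans (mul_le_mul_of_nonneg_left hv.h1Norm_le hK)
    rw [hf v hv.memH1fin, hint, Complex.norm_real] at h
    have h2 : S.mass R.envFinset * S.osc 1 f R.env ≤ S.mass R.envFinset * (2 * K) := by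
      linarith [le_abs_self (S.mass R.envFinset * S.osc 1 f R.env),
        Real.norm_eq_abs (S.mass R.envFinset * S.osc 1 f R.env)]
    exact (le_of_mul_le_mul_left h2 hpos).trans (mul_le_mul_of_nonneg_right hC hK)
  have : Nonempty S.AdmTrap := ⟨⟨o, 1, le_rfl, true, fun _ => rfl⟩⟩
  refine ⟨f, ⟨HomTreeSetting.atomConst m * K, ?_⟩, hf, ciSup_le hosc,
    fun f' _ hf' => ⟨f' o - f o, fun x => ?_⟩⟩
  · rintro _ ⟨R, rfl⟩
    exact hosc R
  · obtain ⟨t, ht⟩ := HomTreeSetting.exists_finDecomp_dipole o x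
    have h := (hf' _ ht.memH1fin).symm.trans (hf _ ht.memH1fin)
    rw [HomTreeSetting.integral_mul_dipole, HomTreeSetting.integral_mul_dipole] at h
    linear_combination h
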